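/- arXiv:1811.01234 — 3 statements merged into one kernel-verified Lean document; each statement's English description precedes it below -/
import Mathlib

section
/- The family {U_a : a ∈ K} is a base for the topology on I it generates; in particular, every point of I lies in some U_a, and for every pair a, b ∈ K and every S ∈ U_a ∩ U_b there exists c ∈ K such that S ∈ U_c and U_c ⊆ U_a ∩ U_b. -/
/-- A subset `S` of a partially ordered set is *upward directed* if any two of its
elements have an upper bound in `S`. -/
def IsUpDirected {K : Type*} [PartialOrder K] (S : Set K) : Prop :=
  ∀ a ∈ S, ∀ b ∈ S, ∃ c ∈ S, a ≤ c ∧ b ≤ c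

/-- A *maximal upward directed subset*: upward directed and maximal with respect to
inclusion among upward directed subsets. -/
def IsMaxUpDirected {K : Type*} [PartialOrder K] (S : Set K) : Prop :=
  IsUpDirected S ∧ ∀ T : Set K, IsUpDirected T → S ⊆ T → T = S

/-- The index set `I` of all maximal upward directed subsets of `K`. -/
def Idx (K : Type*) [PartialOrder K] := {S : Set K // IsMaxUpDirected S}

/-- `U a = { S ∈ I : a ∈ S }`. -/
def U {K : Type*} [PartialOrder K] (a : K) : Set (Idx K) := {S : Idx K | a ∈ S.1}

/-- The topology `τ` on `I` generated by the family `{U a : a ∈ K}`. -/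
def tau (K : Type*) [PartialOrder K] : TopologicalSpace (Idx K) :=
  TopologicalSpace.generateFrom (Set.range (fun a : K => U a))

theorem IsUpDirected.lowerClosure {K : Type*} [PartialOrder K] {S : Set K}
    (hS : IsUpDirected S) : IsUpDirected {x | ∃ s ∈ S, x ≤ s} := by
  rintro a ⟨s, hs, has⟩ b ⟨t, ht, hbt⟩
  obtain ⟨c, hc, hsc, htc⟩ := hS s hs t ht
  exact ⟨c, ⟨c, hc, le_rfl⟩, has.trans hsc, hbt.trans htc⟩

theorem IsMaxUpDirected.isLowerSet {K : Type*} [PartialOrder K] {S : Set K}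
    (hS : IsMaxUpDirected S) : IsLowerSet S := by
  intro c a hac hc
  rw [← hS.2 _ hS.1.lowerClosure fun x hx => ⟨x, hx, le_rfl⟩]
  exact ⟨c, hc, hac⟩

theorem IsMaxUpDirected.nonempty {K : Type*} [PartialOrder K] [Nonempty K] {S : Set K}
    (hS : IsMaxUpDirected S) : S.Nonempty := by
  by_contra h
  rw [Set.not_nonempty_iff_eq_empty] at h
  subst h
  obtain ⟨k⟩ := ‹Nonempty K›
  refine Set.singleton_ne_empty k (hS.2 {k} ?_ (Set.empty_subset _))
  rintro a rfl b rfl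
  exact ⟨_, rfl, le_rfl, le_rfl⟩

theorem exists_mem_U {K : Type*} [PartialOrder K] [Nonempty K] (S : Idx K) :
    ∃ a : K, S ∈ U a :=
  S.2.nonempty

theorem exists_mem_U_subset_inter {K : Type*} [PartialOrder K] {a b : K} {S : Idx K}
    (hS : S ∈ U a ∩ U b) : ∃ c : K, S ∈ U c ∧ U c ⊆ U a ∩ U b := by
  obtain ⟨c, hc, hac, hbc⟩ := S.2.1 a hS.1 b hS.2
  exact ⟨c, hc, fun T hT => ⟨T.2.isLowerSet hac hT, T.2.isLowerSet hbc hT⟩⟩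

/-- The family `{U a : a ∈ K}` is a base for the topology on `I` it generates:
every point of `I` lies in some `U a`, and for all `a, b ∈ K` and every
`S ∈ U a ∩ U b` there is `c ∈ K` with `S ∈ U c ⊆ U a ∩ U b`. -/
theorem U_isTopologicalBasis (K : Type*) [PartialOrder K] [Nonempty K] :
    @TopologicalSpace.IsTopologicalBasis (Idx K) (tau K)
        (Set.range (fun a : K => U a)) ∧
    (∀ S : Idx K, ∃ a : K, S ∈ U a) ∧
    (∀ a b : K, ∀ S : Idx K, S ∈ U a ∩ U b →
      ∃ c : K, S ∈ U c ∧ U c ⊆ U a ∩ U b) := by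
  refine ⟨@TopologicalSpace.IsTopologicalBasis.mk _ (tau K) _ ?_ ?_ rfl, exists_mem_U,
    fun a b S hS => exists_mem_U_subset_inter hS⟩
  · rintro _ ⟨a, rfl⟩ _ ⟨b, rfl⟩ S hS
    obtain ⟨c, hc, hsub⟩ := exists_mem_U_subset_inter hS
    exact ⟨U c, ⟨c, rfl⟩, hc, hsub⟩
  · refine Set.eq_univ_of_forall fun S => ?_
    obtain ⟨a, ha⟩ := exists_mem_U S
    exact ⟨U a, ⟨a, rfl⟩, ha⟩
end

section
/- If a ∈ K and U_a is the singleton {S} for some maximal upward directed subset S of K, then K^a := {b ∈ K : a ≤ b} is contained in S. -/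
theorem IsUpDirected.sUnion {K : Type*} [PartialOrder K] {c : Set (Set K)}
    (hc : IsChain (· ⊆ ·) c) (h : ∀ T ∈ c, IsUpDirected T) : IsUpDirected (⋃₀ c) := by
  rintro x ⟨X, hX, hx⟩ y ⟨Y, hY, hy⟩
  obtain hXY | hYX := hc.total hX hY
  · obtain ⟨z, hz, hxz, hyz⟩ := h Y hY x (hXY hx) y hy
    exact ⟨z, ⟨Y, hY, hz⟩, hxz, hyz⟩
  · obtain ⟨z, hz, hxz, hyz⟩ := h X hX x hx y (hYX hy)
    exact ⟨z, ⟨X, hX, hz⟩, hxz, hyz⟩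

theorem IsUpDirected.exists_isMaxUpDirected_superset {K : Type*} [PartialOrder K] {T : Set K}
    (hT : IsUpDirected T) : ∃ M, T ⊆ M ∧ IsMaxUpDirected M := by
  obtain ⟨M, hTM, hM⟩ := zorn_subset_nonempty {T : Set K | IsUpDirected T}
    (fun c hc hchain _ ↦ ⟨⋃₀ c, IsUpDirected.sUnion hchain hc,
      fun _ hs ↦ Set.subset_sUnion_of_mem hs⟩) T hT
  exact ⟨M, hTM, hM.prop, fun N hN hMN ↦ (hM.eq_of_subset hN hMN).symm⟩

theorem isUpDirected_pair {K : Type*} [PartialOrder K] {a b : K} (hab : a ≤ b) :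
    IsUpDirected ({a, b} : Set K) := by
  intro x hx y hy
  refine ⟨b, by simp, ?_, ?_⟩
  · rcases hx with rfl | rfl <;> simp [hab]
  · rcases hy with rfl | rfl <;> simp [hab]

/-- If `U a = {S}` for a maximal upward directed subset `S`, then
`K^a = {b : a ≤ b}` is contained in `S`. -/
theorem Ka_subset_of_U_singleton {K : Type*} [PartialOrder K] (a : K)
    (S : Set K) (hS : IsMaxUpDirected S)
    (h : U a = {(⟨S, hS⟩ : Idx K)}) :
    {b : K | a ≤ b} ⊆ S := by
  intro b hab
  obtain ⟨M, habM, hM⟩ := (isUpDirected_pair hab).exists_isMaxUpDirected_superset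
  have hmem : (⟨M, hM⟩ : Idx K) ∈ U a := habM (Set.mem_insert a {b})
  have hMS : M = S := congrArg Subtype.val (Set.mem_singleton_iff.mp (h.subset hmem))
  exact hMS ▸ habM (Set.mem_insert_of_mem a rfl)
end

section
/- Let K := {(n, m) ∈ ℤ × ℤ : m ≤ 0} carry the partial order: (n₁, m₁) ≤ (n₂, m₂) iff m₂ − m₁ ≥ n₂ − n₁ ≥ 0. Then the topology τ on the set I of maximal upward directed subsets of K is discrete: every one-point subset of I is τ-open. In particular, for every n ∈ ℤ one has U_{(n,0)} = {S} for a single maximal upward directed subset S of K. -/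
/-- A subset `S` is *upward directed* with respect to a relation `r` if any two of
its elements have an `r`-upper bound in `S`. -/
def IsUpDirectedRel {α : Type*} (r : α → α → Prop) (S : Set α) : Prop :=
  ∀ a ∈ S, ∀ b ∈ S, ∃ c ∈ S, r a c ∧ r b c

/-- A *maximal upward directed subset* with respect to `r`: upward directed and
maximal with respect to inclusion among upward directed subsets. -/
def IsMaxUpDirectedRel {α : Type*} (r : α → α → Prop) (S : Set α) : Prop :=
  IsUpDirectedRel r S ∧ ∀ T : Set α, IsUpDirectedRel r T → S ⊆ T → T = S

/-- The index set `I` of all maximal upward directed subsets. -/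
def IdxRel {α : Type*} (r : α → α → Prop) := {S : Set α // IsMaxUpDirectedRel r S}

/-- `U a = { S ∈ I : a ∈ S }`. -/
def URel {α : Type*} (r : α → α → Prop) (a : α) : Set (IdxRel r) :=
  {S : IdxRel r | a ∈ S.1}

/-- The topology `τ` on `I` generated by the family `{U a}`. -/
def tauRel {α : Type*} (r : α → α → Prop) : TopologicalSpace (IdxRel r) :=
  TopologicalSpace.generateFrom (Set.range (fun a : α => URel r a))

/-- The set `K = {(n, m) ∈ ℤ × ℤ : m ≤ 0}` as a type. -/
def K15 : Type := {p : ℤ × ℤ // p.2 ≤ 0}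

/-- The partial order on `K15`: `(n₁,m₁) ≤ (n₂,m₂)` iff `m₂ - m₁ ≥ n₂ - n₁ ≥ 0`. -/
def le15 (p q : K15) : Prop :=
  q.1.2 - p.1.2 ≥ q.1.1 - p.1.1 ∧ q.1.1 - p.1.1 ≥ 0

theorem le15_refl (p : K15) : le15 p p := by
  simp [le15]

theorem le15_trans {p q s : K15} (hpq : le15 p q) (hqs : le15 q s) : le15 p s := by
  unfold le15 at *
  omega

theorem le15_eq_of_snd_le {p q : K15} (h : le15 p q) (hm : q.1.2 ≤ p.1.2) : q = p := by
  unfold le15 at h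
  apply Subtype.ext
  apply Prod.ext <;> omega

/-- The lower set of an element is upward directed. -/
theorem isUpDirectedRel_lower (q : K15) : IsUpDirectedRel le15 {p | le15 p q} :=
  fun _ ha _ hb => ⟨q, le15_refl q, ha, hb⟩

/-- An upward directed set containing `(n, 0)` lies below `(n, 0)`. -/
theorem IsUpDirectedRel.subset_lower {T : Set K15} (hT : IsUpDirectedRel le15 T) {q : K15}
    (hq : q.1.2 = 0) (hqT : q ∈ T) : T ⊆ {p | le15 p q} := by
  intro p hp
  obtain ⟨c, -, hqc, hpc⟩ := hT q hqT p hp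
  rwa [le15_eq_of_snd_le hqc (c.2.trans hq.ge)] at hpc

theorem isMaxUpDirectedRel_lower {q : K15} (hq : q.1.2 = 0) :
    IsMaxUpDirectedRel le15 {p | le15 p q} :=
  ⟨isUpDirectedRel_lower q, fun _ hT hsub =>
    (hT.subset_lower hq (hsub (le15_refl q))).antisymm hsub⟩

/-- The lower set of `(n, 0)` as a maximal upward directed subset. -/
def lowerIdx (q : K15) (hq : q.1.2 = 0) : IdxRel le15 :=
  ⟨{p | le15 p q}, isMaxUpDirectedRel_lower hq⟩

theorem URel_eq_singleton {q : K15} (hq : q.1.2 = 0) : URel le15 q = {lowerIdx q hq} := by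
  ext S
  constructor
  · intro hS
    exact Subtype.ext
      (S.2.2 _ (isUpDirectedRel_lower q) (S.2.1.subset_lower hq hS)).symm
  · rintro rfl
    exact le15_refl q

theorem IsMaxUpDirectedRel.nonempty {S : Set K15} (hS : IsMaxUpDirectedRel le15 S) :
    S.Nonempty := by
  by_contra h
  rw [Set.not_nonempty_iff_eq_empty] at h
  subst h
  let q : K15 := ⟨(0, 0), le_refl 0⟩
  have hq := hS.2 _ (isUpDirectedRel_lower q) (Set.empty_subset _)
  exact Set.eq_empty_iff_forall_notMem.mp hq q (le15_refl q)

/-- A nonempty upward directed subset of `K15` has a greatest element. -/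
theorem IsUpDirectedRel.exists_greatest {S : Set K15} (hS : IsUpDirectedRel le15 S)
    (hne : S.Nonempty) : ∃ q ∈ S, ∀ p ∈ S, le15 p q := by
  obtain ⟨p₀, hp₀⟩ := hne
  obtain ⟨_, ⟨q, hq, rfl⟩, hmax⟩ := Int.exists_greatest_of_bdd
    (P := fun m => ∃ q ∈ S, q.1.2 = m) ⟨0, by rintro _ ⟨q, -, rfl⟩; exact q.2⟩
    ⟨_, p₀, hp₀, rfl⟩
  refine ⟨q, hq, fun p hp => ?_⟩
  obtain ⟨c, hc, hqc, hpc⟩ := hS q hq p hp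
  rwa [le15_eq_of_snd_le hqc (hmax _ ⟨c, hc, rfl⟩)] at hpc

/-- Every maximal upward directed subset contains some `(n, 0)`. -/
theorem IsMaxUpDirectedRel.exists_snd_eq_zero_mem {S : Set K15}
    (hS : IsMaxUpDirectedRel le15 S) : ∃ q ∈ S, q.1.2 = 0 := by
  obtain ⟨q, -, hq⟩ := hS.1.exists_greatest hS.nonempty
  let t : K15 := ⟨(q.1.1, 0), le_refl 0⟩
  have hqt : le15 q t := by
    have := q.2
    simp only [le15, t]
    omega
  refine ⟨t, ?_, rfl⟩
  rw [← hS.2 _ (isUpDirectedRel_lower t) fun p hp => le15_trans (hq p hp) hqt]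
  exact le15_refl t

/-- The topology `τ` on `I` is discrete: every one-point subset of `I` is `τ`-open;
in particular for every `n ∈ ℤ`, `U (n, 0)` is a singleton `{S}`. -/
theorem tau_discrete :
    (∀ S : IdxRel le15, (tauRel le15).IsOpen ({S} : Set (IdxRel le15))) ∧
    (∀ n : ℤ, ∃ S : IdxRel le15,
      URel le15 (⟨(n, 0), le_refl 0⟩ : K15) = {S}) := by
  refine ⟨fun S => ?_, fun n => ⟨_, URel_eq_singleton rfl⟩⟩
  obtain ⟨q, hqS, hq⟩ := S.2.exists_snd_eq_zero_mem
  have hS : S ∈ URel le15 q := hqS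
  have hU := URel_eq_singleton hq
  rw [hU, Set.mem_singleton_iff] at hS
  rw [hS, ← hU]
  exact TopologicalSpace.GenerateOpen.basic _ ⟨q, rfl⟩
end
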